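/- Let F be a Borel probability measure on [0,∞) that follows a power law with tail exponent α > d, and let h : [0,∞) → [0,1] be a measurable function with h(r) → 1 as r → ∞. Then ∫_{[0,∞)} |B_r(0) ∩ B_r(z)|·h(r) F(dr) / (c_{α,d}·|z|^d·F̄(|z|)) → 1 as |z| → ∞, where c_{α,d} = ∫₀^∞ |B_r(0) ∩ B_r(e₁)|·α·r^{−α−1} dr and e₁ is the first standard basis vector of ℝ^d. -/

import Mathlib

open MeasureTheory Filter Set Metric ProbabilityTheory

noncomputable section

/-- A measurable positive function is slowly varying at infinity if `ℓ(a t)/ℓ(t) → 1`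
as `t → ∞` for every `a > 0`. -/
def SlowlyVarying (ℓ : ℝ → ℝ) : Prop :=
  Measurable ℓ ∧ (∀ x > 0, 0 < ℓ x) ∧
    ∀ a > 0, Tendsto (fun t => ℓ (a * t) / ℓ t) atTop (nhds 1)

/-- Tail function `F̄(x) = F((x,∞))` of a measure on `ℝ`. -/
def tailF (F : Measure ℝ) (x : ℝ) : ℝ := (F (Ioi x)).toReal

/-- `d`-dimensional Euclidean space. -/
abbrev Euc (d : ℕ) := EuclideanSpace ℝ (Fin d)

/-- The first standard basis vector of `ℝ^d`. -/
def e1 (d : ℕ) : Euc d := if h : 0 < d then EuclideanSpace.single (⟨0, h⟩ : Fin d) 1 else 0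

/-- Volume of the closed ball of radius `r` in `ℝ^d`. -/
def ballVol (d : ℕ) (r : ℝ) : ℝ := (volume (closedBall (0 : Euc d) r)).toReal

/-- Volume of the intersection of closed balls `B_r(x)` and `B_s(y)` in `ℝ^d`. -/
def interVol (d : ℕ) (x : Euc d) (r : ℝ) (y : Euc d) (s : ℝ) : ℝ :=
  (volume (closedBall x r ∩ closedBall y s)).toReal

/-- The constant `c_{α,d} = ∫₀^∞ |B_r(0) ∩ B_r(e₁)| α r^{-α-1} dr`. -/
def cconst (d : ℕ) (α : ℝ) : ℝ :=
  ∫ r in Ioi (0 : ℝ), interVol d 0 r (e1 d) r * (α * r ^ (-α - 1))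

/-- `F` follows a power law with tail exponent `α`: `F̄(r) = ℓ(r) r^{-α}` with `ℓ`
slowly varying. -/
def IsPowerLaw (F : Measure ℝ) (α : ℝ) : Prop :=
  ∃ ℓ : ℝ → ℝ, SlowlyVarying ℓ ∧ ∀ x > 0, tailF F x = ℓ x * x ^ (-α)

/-- `m(y) = max(|y|, |y - e₁|)`. -/
def mfun (d : ℕ) (y : Euc d) : ℝ := max ‖y‖ ‖y - e1 d‖

lemma norm_e1 {d : ℕ} (hd : 0 < d) : ‖e1 d‖ = 1 := by
  simp [e1, hd]

lemma mfun_cont (d : ℕ) : Continuous (mfun d) := by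
  unfold mfun; fun_prop

lemma mfun_half {d : ℕ} (hd : 0 < d) (y : Euc d) : 1 / 2 ≤ mfun d y := by
  have h1 : ‖y‖ ≤ mfun d y := le_max_left _ _
  have h2 : ‖y - e1 d‖ ≤ mfun d y := le_max_right _ _
  have h3 : ‖e1 d‖ ≤ ‖y‖ + ‖y - e1 d‖ := by
    have := norm_sub_le y (y - e1 d)
    simpa using this
  rw [norm_e1 hd] at h3
  linarith

lemma mfun_lower {d : ℕ} (hd : 0 < d) (y : Euc d) : (1 + ‖y‖) / 3 ≤ mfun d y := by
  have h1 : ‖y‖ ≤ mfun d y := le_max_left _ _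
  have h2 := mfun_half hd y
  linarith

lemma interVol_scale {d : ℕ} (hd : 0 < d) (z : Euc d) (hz : 0 < ‖z‖) (r : ℝ) :
    interVol d 0 r z r = ‖z‖ ^ d * interVol d 0 (r / ‖z‖) (e1 d) (r / ‖z‖) := by
  set R := ‖z‖ with hR
  have hn : ‖R • e1 d‖ = ‖z‖ := by
    rw [norm_smul, norm_e1 hd]; simp [hR]
  let ρ : Euc d ≃ₗᵢ[ℝ] Euc d := Submodule.reflection (Submodule.span ℝ {R • e1 d - z})ᗮ
  have hρ : ρ (R • e1 d) = z := Submodule.reflection_sub hn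
  have hpre : ρ ⁻¹' (closedBall 0 r ∩ closedBall z r) =
      closedBall 0 r ∩ closedBall (R • e1 d) r := by
    ext x
    simp only [mem_preimage, mem_inter_iff, mem_closedBall]
    rw [← hρ, ρ.dist_map]
    nth_rewrite 1 [← ρ.map_zero]
    rw [ρ.dist_map]
  have hsm : closedBall (0 : Euc d) r ∩ closedBall (R • e1 d) r =
      (fun x => R⁻¹ • x) ⁻¹' (closedBall (0 : Euc d) (r / R) ∩ closedBall (e1 d) (r / R)) := by
    ext x
    have e : R⁻¹ • x - e1 d = R⁻¹ • (x - R • e1 d) := by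
      rw [smul_sub, smul_smul, inv_mul_cancel₀ hz.ne', one_smul]
    simp only [mem_preimage, mem_inter_iff, mem_closedBall, dist_eq_norm, sub_zero]
    rw [e, norm_smul, norm_smul, norm_inv, Real.norm_of_nonneg hz.le, inv_mul_eq_div,
      inv_mul_eq_div, div_le_div_iff_of_pos_right hz, div_le_div_iff_of_pos_right hz]
  unfold interVol
  rw [← ρ.measurePreserving.measure_preimage
    (measurableSet_closedBall.inter measurableSet_closedBall).nullMeasurableSet, hpre, hsm,
    Measure.addHaar_preimage_smul _ (inv_ne_zero hz.ne'), ENNReal.toReal_mul,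
    ENNReal.toReal_ofReal (abs_nonneg _)]
  simp [abs_of_pos hz]

lemma vol_eq {d : ℕ} (hd : 0 < d) (r : ℝ) :
    volume (closedBall (0 : Euc d) r ∩ closedBall (e1 d) r) =
      volume {y : Euc d | mfun d y < r} := by
  have : Nonempty (Fin d) := ⟨⟨0, hd⟩⟩
  have key : ∀ x : Euc d, (closedBall x r : Set (Euc d)) =ᵐ[volume] ball x r := by
    intro x
    refine (ae_eq_of_subset_of_measure_ge ball_subset_closedBall ?_
      measurableSet_ball.nullMeasurableSet measure_closedBall_lt_top.ne).symm
    rw [Measure.addHaar_closedBall_eq_addHaar_ball]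
  have e : {y : Euc d | mfun d y < r} = ball (0 : Euc d) r ∩ ball (e1 d) r := by
    ext y
    simp [mfun, dist_eq_norm]
  rw [e]
  exact measure_congr ((key 0).inter (key _))

lemma interVol_meas (d : ℕ) (R : ℝ) (hR : 0 < R) :
    Measurable fun r : ℝ => interVol d 0 (r / R) (e1 d) (r / R) := by
  apply Monotone.measurable
  intro a b hab
  have : a / R ≤ b / R := by gcongr
  unfold interVol
  apply ENNReal.toReal_mono
  · exact ((measure_mono inter_subset_left).trans_lt measure_closedBall_lt_top).ne
  · exact measure_mono (inter_subset_inter (closedBall_subset_closedBall this)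
      (closedBall_subset_closedBall this))

lemma key_fubini {d : ℕ} (hd : 0 < d) (G : Measure ℝ) [SFinite G] (w : ℝ → ℝ)
    (hw : Measurable w) (hw0 : 0 ≤ᵐ[G] w) (R : ℝ) (hR : 0 < R)
    (hfin : ∀ x > 0, G.withDensity (fun r => ENNReal.ofReal (w r)) (Ioi x) < ⊤) :
    ∫ r, interVol d 0 (r / R) (e1 d) (r / R) * w r ∂G =
      ∫ y : Euc d, (G.withDensity (fun r => ENNReal.ofReal (w r)) (Ioi (R * mfun d y))).toReal := by
  have hmm : Measurable (mfun d) := (mfun_cont d).measurable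
  have hmi := interVol_meas d R hR
  rw [integral_toReal, integral_eq_lintegral_of_nonneg_ae]
  · congr 1
    have e1' : ∀ r, ENNReal.ofReal (interVol d 0 (r / R) (e1 d) (r / R)) =
        ∫⁻ y : Euc d, {p : ℝ × Euc d | R * mfun d p.2 < p.1}.indicator 1 (r, y) := by
      intro r
      have hfin' : volume (closedBall (0 : Euc d) (r / R) ∩ closedBall (e1 d) (r / R)) ≠ ⊤ :=
        ((measure_mono inter_subset_left).trans_lt measure_closedBall_lt_top).ne
      unfold interVol
      rw [ENNReal.ofReal_toReal hfin', vol_eq hd,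
        ← lintegral_indicator_one (measurableSet_lt hmm measurable_const)]
      congr 1
      ext y
      simp only [indicator, mem_ofPred_eq, lt_div_iff₀ hR, mul_comm R]
      rfl
    have hS : MeasurableSet {p : ℝ × Euc d | R * mfun d p.2 < p.1} :=
      measurableSet_lt (by fun_prop) (by fun_prop)
    calc _ = ∫⁻ r, ((fun r => ENNReal.ofReal (w r)) *
            fun r => ENNReal.ofReal (interVol d 0 (r / R) (e1 d) (r / R))) r ∂G := by
          apply lintegral_congr
          intro r
          rw [ENNReal.ofReal_mul (show 0 ≤ interVol d 0 (r / R) (e1 d) (r / R) from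
            ENNReal.toReal_nonneg), mul_comm]
          rfl
      _ = _ := (lintegral_withDensity_eq_lintegral_mul G hw.ennreal_ofReal
            hmi.ennreal_ofReal).symm
      _ = ∫⁻ r, ∫⁻ y : Euc d, {p : ℝ × Euc d | R * mfun d p.2 < p.1}.indicator 1 (r, y)
            ∂volume ∂(G.withDensity (fun r => ENNReal.ofReal (w r))) := lintegral_congr e1'
      _ = _ := lintegral_lintegral_swap (by
            apply Measurable.aemeasurable
            exact measurable_one.indicator hS)
      _ = _ := by
          apply lintegral_congr
          intro y
          rw [← lintegral_indicator_one measurableSet_Ioi]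
          rfl
  · filter_upwards [hw0] with r hr
    exact mul_nonneg ENNReal.toReal_nonneg hr
  · exact (hmi.mul hw).aestronglyMeasurable
  · apply Measurable.aemeasurable
    have : Antitone fun x : ℝ => G.withDensity (fun r => ENNReal.ofReal (w r)) (Ioi x) :=
      fun a b hab => measure_mono (Ioi_subset_Ioi hab)
    exact this.measurable.comp (by fun_prop)
  · refine Eventually.of_forall fun y => hfin _ ?_
    have := mfun_half hd y
    exact mul_pos hR (by linarith)

lemma pow_tail (α : ℝ) (hα : 0 < α) (x : ℝ) (hx : 0 < x) :
    (volume.restrict (Ioi (0 : ℝ))).withDensity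
      (fun r => ENNReal.ofReal (α * r ^ (-α - 1))) (Ioi x) = ENNReal.ofReal (x ^ (-α)) := by
  rw [withDensity_apply _ measurableSet_Ioi, Measure.restrict_restrict measurableSet_Ioi]
  have : Ioi x ∩ Ioi (0 : ℝ) = Ioi x := by
    rw [Ioi_inter_Ioi, sup_eq_left.2 hx.le]
  rw [this, ← ofReal_integral_eq_lintegral_ofReal]
  · rw [integral_const_mul, integral_Ioi_rpow_of_lt (by linarith) hx]
    congr 1
    have : -α - 1 + 1 = -α := by ring
    rw [this]
    field_simp
  · exact (integrableOn_Ioi_rpow_of_lt (by linarith) hx).const_mul α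
  · filter_upwards [ae_restrict_mem measurableSet_Ioi] with r hr
    have : (0 : ℝ) < r := hx.trans hr
    show (0 : ℝ) ≤ _
    positivity

lemma cconst_eq {d : ℕ} (hd : 0 < d) (α : ℝ) (hα : 0 < α) :
    cconst d α = ∫ y : Euc d, mfun d y ^ (-α) := by
  have hpos : ∀ y : Euc d, 0 < mfun d y := fun y => by linarith [mfun_half hd y]
  have := key_fubini hd (volume.restrict (Ioi (0 : ℝ))) (fun r => α * r ^ (-α - 1))
    (by fun_prop) (by
      filter_upwards [ae_restrict_mem measurableSet_Ioi] with r hr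
      have : (0 : ℝ) < r := hr
      show (0 : ℝ) ≤ _
      positivity) 1 one_pos (by
      intro x hx
      rw [pow_tail α hα x hx]
      exact ENNReal.ofReal_lt_top)
  simp only [div_one, one_mul] at this
  unfold cconst
  rw [this]
  congr 1
  ext y
  rw [pow_tail α hα _ (hpos y), ENNReal.toReal_ofReal (Real.rpow_nonneg (hpos y).le _)]

lemma mfun_integrable {d : ℕ} (hd : 0 < d) (β : ℝ) (hβ : (d : ℝ) < β) :
    Integrable (fun y : Euc d => mfun d y ^ (-β)) := by
  have hb : 0 < β := (Nat.cast_nonneg d).trans_lt hβ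
  have hpos : ∀ y : Euc d, 0 < mfun d y := fun y => by linarith [mfun_half hd y]
  have h1 : Integrable (fun y : Euc d => (1 + ‖y‖) ^ (-β)) :=
    integrable_one_add_norm (by simpa using hβ)
  refine (h1.const_mul ((3 : ℝ) ^ β)).mono' ?_ ?_
  · exact ((mfun_cont d).measurable.pow_const _).aestronglyMeasurable
  · refine Eventually.of_forall fun y => ?_
    rw [Real.norm_of_nonneg (Real.rpow_nonneg (hpos y).le _)]
    calc mfun d y ^ (-β) ≤ ((1 + ‖y‖) / 3) ^ (-β) :=
          Real.rpow_le_rpow_of_nonpos (by positivity) (mfun_lower hd y) (by linarith)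
      _ = _ := by
          rw [Real.div_rpow (by positivity) (by norm_num), Real.rpow_neg (by norm_num : (0:ℝ) ≤ 3)]
          field_simp

lemma cconst_pos {d : ℕ} (hd : 0 < d) (α : ℝ) (hα : (d : ℝ) < α) : 0 < cconst d α := by
  have ha : 0 < α := (Nat.cast_nonneg d).trans_lt hα
  have hpos : ∀ y : Euc d, 0 < mfun d y := fun y => by linarith [mfun_half hd y]
  rw [cconst_eq hd α ha, integral_pos_iff_support_of_nonneg
    (fun y => Real.rpow_nonneg (hpos y).le _) (mfun_integrable hd α hα)]
  have : Function.support (fun y : Euc d => mfun d y ^ (-α)) = univ := by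
    ext y
    simpa using (Real.rpow_pos_of_pos (hpos y) _).ne'
  rw [this]
  exact Measure.measure_univ_pos.2 (NeZero.ne _)

lemma tail_anti (F : Measure ℝ) [IsProbabilityMeasure F] : Antitone (tailF F) := by
  intro a b hab
  exact ENNReal.toReal_mono (measure_ne_top _ _) (measure_mono (Ioi_subset_Ioi hab))

lemma tail_pos (F : Measure ℝ) (α : ℝ) (hpow : IsPowerLaw F α) (x : ℝ) (hx : 0 < x) :
    0 < tailF F x := by
  obtain ⟨l, hl, hF⟩ := hpow
  rw [hF x hx]
  exact mul_pos (hl.2.1 x hx) (Real.rpow_pos_of_pos hx _)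

lemma tail_ratio (F : Measure ℝ) (α : ℝ) (hpow : IsPowerLaw F α) (a : ℝ) (ha : 0 < a) :
    Tendsto (fun R => tailF F (R * a) / tailF F R) atTop (nhds (a ^ (-α))) := by
  obtain ⟨l, hl, hF⟩ := hpow
  have := (hl.2.2 a ha).mul_const (a ^ (-α))
  rw [one_mul] at this
  refine this.congr' ?_
  filter_upwards [eventually_gt_atTop 0] with R hR
  have h1 := (hl.2.1 R hR).ne'
  have h2 := (Real.rpow_pos_of_pos hR (-α)).ne'
  rw [hF _ (mul_pos hR ha), hF _ hR, Real.mul_rpow hR.le ha.le, mul_comm a R]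
  field_simp

lemma potter (F : Measure ℝ) [IsProbabilityMeasure F] (α β : ℝ) (hβ : 0 < β) (hβα : β < α)
    (hpow : IsPowerLaw F α) :
    ∃ C : ℝ, ∀ᶠ R in atTop, ∀ a ≥ (1 / 2 : ℝ), tailF F (R * a) ≤ C * a ^ (-β) * tailF F R := by
  have hq : (2 : ℝ) ^ (-α) < 2 ^ (-β) :=
    Real.rpow_lt_rpow_of_exponent_lt (by norm_num) (by linarith)
  have hq0 : (0 : ℝ) < 2 ^ (-β) := by positivity
  have ev1 := (tail_ratio F α hpow 2 (by norm_num)).eventually (eventually_lt_nhds hq)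
  obtain ⟨R0, hR0⟩ := eventually_atTop.1 (ev1.and (eventually_gt_atTop 0))
  have step : ∀ R ≥ R0, tailF F (R * 2) ≤ 2 ^ (-β) * tailF F R := by
    intro R hR
    have h := hR0 R hR
    exact ((div_lt_iff₀ (tail_pos F α hpow R h.2)).1 h.1).le
  have hR0pos : ∀ R ≥ R0, 0 < R := fun R hR => (hR0 R hR).2
  have iter : ∀ k : ℕ, ∀ R ≥ R0, tailF F (R * 2 ^ k) ≤ (2 ^ (-β)) ^ k * tailF F R := by
    intro k
    induction k with
    | zero => intro R _; simp
    | succ k ih =>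
      intro R hR
      have hRp := hR0pos R hR
      have h1 : R0 ≤ R * 2 ^ k :=
        hR.le.trans (le_mul_of_one_le_right hRp.le (one_le_pow₀ (by norm_num)))
      calc tailF F (R * 2 ^ (k + 1)) = tailF F (R * 2 ^ k * 2) := by rw [pow_succ]; ring_nf
        _ ≤ 2 ^ (-β) * tailF F (R * 2 ^ k) := step _ h1
        _ ≤ 2 ^ (-β) * ((2 ^ (-β)) ^ k * tailF F R) := by gcongr; exact ih R hR
        _ = _ := by rw [pow_succ]; ring
  have big : ∀ R ≥ R0, ∀ b ≥ (1 : ℝ), tailF F (R * b) ≤ (b / 2) ^ (-β) * tailF F R := by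
    intro R hR b hb
    have hRp := hR0pos R hR
    obtain ⟨k, hk1, hk2⟩ := exists_nat_pow_near hb (by norm_num : (1 : ℝ) < 2)
    have hT := (tail_pos F α hpow R hRp).le
    calc tailF F (R * b) ≤ tailF F (R * 2 ^ k) := tail_anti F (by gcongr)
      _ ≤ (2 ^ (-β)) ^ k * tailF F R := iter k R hR
      _ = ((2 : ℝ) ^ k) ^ (-β) * tailF F R := by
          rw [← Real.rpow_natCast, ← Real.rpow_natCast, ← Real.rpow_mul (by norm_num),
            ← Real.rpow_mul (by norm_num), mul_comm (-β)]
      _ ≤ _ := by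
          refine mul_le_mul_of_nonneg_right ?_ hT
          refine Real.rpow_le_rpow_of_nonpos (by positivity) ?_ (by linarith)
          rw [pow_succ] at hk2
          linarith
  have ev2 := (tail_ratio F α hpow (1 / 2) (by norm_num)).eventually
    (eventually_lt_nhds (lt_add_one _))
  refine ⟨(1 / 2) ^ (-α) + 1, ?_⟩
  filter_upwards [ev2, eventually_ge_atTop (2 * R0), eventually_gt_atTop 0] with R h2 hR hRp a ha
  have hhalf : tailF F (R * (1 / 2)) ≤ ((1 / 2) ^ (-α) + 1) * tailF F R :=
    ((div_lt_iff₀ (tail_pos F α hpow R hRp)).1 h2).le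
  have hb := big (R * (1 / 2)) (by show R0 ≤ _; linarith) (2 * a) (by show 1 ≤ _; linarith)
  have e1 : R * (1 / 2) * (2 * a) = R * a := by ring
  have e2 : 2 * a / 2 = a := by ring
  rw [e1, e2] at hb
  have hap : 0 ≤ a ^ (-β) := Real.rpow_nonneg (by linarith) _
  calc _ ≤ _ := hb
    _ ≤ a ^ (-β) * (((1 / 2) ^ (-α) + 1) * tailF F R) := by gcongr
    _ = _ := by ring

/-- tail of the measure `h dF` -/
def hTail (F : Measure ℝ) (h : ℝ → ℝ) (x : ℝ) : ℝ :=
  (F.withDensity (fun r => ENNReal.ofReal (h r)) (Ioi x)).toReal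

lemma hTail_le' (F : Measure ℝ) (h : ℝ → ℝ) (h1 : ∀ r, h r ≤ 1) (x : ℝ) :
    F.withDensity (fun r => ENNReal.ofReal (h r)) (Ioi x) ≤ F (Ioi x) := by
  rw [withDensity_apply _ measurableSet_Ioi]
  calc _ ≤ ∫⁻ r in Ioi x, 1 ∂F := lintegral_mono fun r => by
        simpa using h1 r
    _ = _ := by simp

lemma hTail_le (F : Measure ℝ) [IsProbabilityMeasure F] (h : ℝ → ℝ) (h1 : ∀ r, h r ≤ 1) (x : ℝ) :
    hTail F h x ≤ tailF F x :=
  ENNReal.toReal_mono (measure_ne_top _ _) (hTail_le' F h h1 x)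

lemma hTail_ratio (F : Measure ℝ) [IsProbabilityMeasure F] (α : ℝ) (hpow : IsPowerLaw F α)
    (h : ℝ → ℝ) (h1 : ∀ r, h r ≤ 1) (hlim : Tendsto h atTop (nhds 1)) :
    Tendsto (fun x => hTail F h x / tailF F x) atTop (nhds 1) := by
  rw [tendsto_order]
  constructor
  · intro c hc
    by_cases hc0 : c < 0
    · exact Eventually.of_forall fun x => hc0.trans_le
        (div_nonneg ENNReal.toReal_nonneg ENNReal.toReal_nonneg)
    push Not at hc0
    obtain ⟨c', hc1, hc2⟩ := exists_between hc
    obtain ⟨N, hN⟩ := eventually_atTop.1 (hlim.eventually (eventually_gt_nhds hc2))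
    filter_upwards [eventually_ge_atTop N, eventually_gt_atTop 0] with x hx hx0
    have hT := tail_pos F α hpow x hx0
    refine hc1.trans_le ((le_div_iff₀ hT).2 ?_)
    have hfin : F.withDensity (fun r => ENNReal.ofReal (h r)) (Ioi x) ≠ ⊤ :=
      ((hTail_le' F h h1 x).trans_lt (measure_lt_top _ _)).ne
    have : ENNReal.ofReal c' * F (Ioi x) ≤
        F.withDensity (fun r => ENNReal.ofReal (h r)) (Ioi x) := by
      rw [withDensity_apply _ measurableSet_Ioi, ← setLIntegral_const]
      refine setLIntegral_mono' measurableSet_Ioi fun r hr => ?_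
      exact ENNReal.ofReal_le_ofReal (hN r (hx.trans (le_of_lt hr))).le
    have := ENNReal.toReal_mono hfin this
    rw [ENNReal.toReal_mul, ENNReal.toReal_ofReal (by linarith)] at this
    exact this
  · intro c hc
    filter_upwards [eventually_gt_atTop 0] with x hx0
    have hT := tail_pos F α hpow x hx0
    exact ((div_le_one hT).2 (hTail_le F h h1 x)).trans_lt hc

/-- If `h : [0,∞) → [0,1]` tends to `1` at infinity, then
`∫ |B_r(0) ∩ B_r(z)| h(r) F(dr) ∼ c_{α,d} |z|^d F̄(|z|)` as `|z| → ∞`. -/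
theorem stmt19 (d : ℕ) (hd : 0 < d) (F : Measure ℝ) [IsProbabilityMeasure F]
    (hsupp : F (Iio 0) = 0)
    (α : ℝ) (hα : (d : ℝ) < α) (hpow : IsPowerLaw F α)
    (h : ℝ → ℝ) (hm : Measurable h) (h0 : ∀ r, 0 ≤ h r) (h1 : ∀ r, h r ≤ 1)
    (hlim : Tendsto h atTop (nhds 1)) :
    Tendsto
      (fun z : Euc d =>
        (∫ r, interVol d 0 r z r * h r ∂F) /
          (cconst d α * ‖z‖ ^ d * tailF F ‖z‖))
      (comap norm atTop) (nhds 1) := by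
  have hα0 : 0 < α := (Nat.cast_nonneg d).trans_lt hα
  have hpos : ∀ y : Euc d, 0 < mfun d y := fun y => by linarith [mfun_half hd y]
  have hc := cconst_pos hd α hα
  obtain ⟨β, hβ1, hβ2⟩ := exists_between hα
  have hβ0 : 0 < β := (Nat.cast_nonneg d).trans_lt hβ1
  obtain ⟨C, hC⟩ := potter F α β hβ0 hβ2 hpow
  have main : Tendsto (fun R : ℝ => ∫ y : Euc d, hTail F h (R * mfun d y) / tailF F R) atTop
      (nhds (∫ y : Euc d, mfun d y ^ (-α))) := by
    refine tendsto_integral_filter_of_dominated_convergence (fun y => C * mfun d y ^ (-β))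
      ?_ ?_ ((mfun_integrable hd β hβ1).const_mul C) ?_
    · filter_upwards [eventually_gt_atTop 0] with R hR
      have hmm : Measurable (mfun d) := (mfun_cont d).measurable
      have : Antitone fun x : ℝ => F.withDensity (fun r => ENNReal.ofReal (h r)) (Ioi x) :=
        fun a b hab => measure_mono (Ioi_subset_Ioi hab)
      have h2 : Measurable (hTail F h) := this.measurable.ennreal_toReal
      exact ((h2.comp (hmm.const_mul R)).div_const _).aestronglyMeasurable
    · filter_upwards [hC, eventually_gt_atTop 0] with R hCR hR
      refine Eventually.of_forall fun y => ?_
      have hT := tail_pos F α hpow R hR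
      rw [Real.norm_of_nonneg (div_nonneg (show 0 ≤ hTail F h (R * mfun d y) from
        ENNReal.toReal_nonneg) hT.le), div_le_iff₀ hT]
      exact (hTail_le F h h1 _).trans (hCR _ (mfun_half hd y))
    · refine Eventually.of_forall fun y => ?_
      have t1 : Tendsto (fun R : ℝ => R * mfun d y) atTop atTop :=
        tendsto_id.atTop_mul_const (hpos y)
      have t2 := ((hTail_ratio F α hpow h h1 hlim).comp t1).mul
        (tail_ratio F α hpow (mfun d y) (hpos y))
      rw [one_mul] at t2
      refine t2.congr' ?_
      filter_upwards [eventually_gt_atTop 0] with R hR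
      have hT := (tail_pos F α hpow _ (mul_pos hR (hpos y))).ne'
      simp only [Function.comp_apply]
      field_simp
  rw [← cconst_eq hd α hα0] at main
  have main2 := (main.div_const (cconst d α)).comp (tendsto_comap (f := (norm : Euc d → ℝ)))
  rw [div_self hc.ne'] at main2
  refine main2.congr' ?_
  have hev : ∀ᶠ z : Euc d in comap norm atTop, 0 < ‖z‖ :=
    tendsto_comap.eventually (eventually_gt_atTop 0)
  filter_upwards [hev] with z hz
  have hk := key_fubini hd F h hm (Eventually.of_forall h0) ‖z‖ hz
    (fun x _ => (hTail_le' F h h1 x).trans_lt (measure_lt_top _ _))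
  have hT := (tail_pos F α hpow _ hz).ne'
  simp only [Function.comp_apply, interVol_scale hd z hz, mul_assoc, integral_const_mul]
  rw [hk, integral_div]
  unfold hTail
  field_simp
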